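/- Every state outside C_G that is one move of the Glauber dynamics M_G away from a state in C_G lies in C_FL ∪ C_AFL; that is, ∂C_G ⊆ C_FL ∪ C_AFL. -/

import Mathlib

open Finset

/-! Six-vertex model on the `n × n` square lattice region `Λ_n` with free
boundary conditions.

`Edge.horiz k j` is the horizontal edge between `x = k-1` and `x = k` at
height `j`; `Edge.vert i k` is the vertical edge between `y = k-1` and
`y = k` on column `i`.  The vertices of `Λ_n` are the pairs
`(i, j) : Fin n × Fin n`.  An edge configuration assigns `true`
(rightwards / upwards) or `false` (leftwards / downwards) to every edge. -/
inductive Edge (n : ℕ) : Type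
  | horiz (k : Fin (n + 1)) (j : Fin n) : Edge n
  | vert (i : Fin n) (k : Fin (n + 1)) : Edge n
  deriving DecidableEq, Fintype

abbrev EdgeConfig (n : ℕ) := Edge n → Bool

/-- The four edges incident to the vertex `(i, j)` of `Λ_n`. -/
def leftE {n : ℕ} (i j : Fin n) : Edge n := Edge.horiz i.castSucc j
def rightE {n : ℕ} (i j : Fin n) : Edge n := Edge.horiz i.succ j
def botE {n : ℕ} (i j : Fin n) : Edge n := Edge.vert i j.castSucc
def topE {n : ℕ} (i j : Fin n) : Edge n := Edge.vert i j.succ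

/-- The in-degree of the vertex `(i, j)` in the configuration `τ`. -/
def inDegree {n : ℕ} (τ : EdgeConfig n) (i j : Fin n) : ℕ :=
  (cond (τ (leftE i j)) 1 0) + (cond (τ (rightE i j)) 0 1) +
    (cond (τ (botE i j)) 1 0) + (cond (τ (topE i j)) 0 1)

/-- The ice rule: every vertex has exactly two incoming (and hence two
outgoing) incident edges; such a configuration is an Eulerian orientation. -/
def IceRule {n : ℕ} (τ : EdgeConfig n) : Prop :=
  ∀ i j : Fin n, inDegree τ i j = 2

instance {n : ℕ} (τ : EdgeConfig n) : Decidable (IceRule τ) :=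
  inferInstanceAs (Decidable (∀ i j : Fin n, inDegree τ i j = 2))

/-- `Ω`, the state space: all Eulerian orientations of `Λ_n`. -/
def OmegaSet (n : ℕ) : Set (EdgeConfig n) := {τ | IceRule τ}

/-- The state `τ_G`, in which every vertex has six-vertex type `c`. -/
def greenOrient {n : ℕ} : Edge n → Bool
  | Edge.horiz k j => (k.val + j.val) % 2 == 0
  | Edge.vert i k => (i.val + k.val) % 2 == 1

def tauG (n : ℕ) : EdgeConfig n := greenOrient

/-- The state `τ_R`, the total edge reversal of `τ_G`. -/
def tauR (n : ℕ) : EdgeConfig n := fun e => !(greenOrient e)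

/-- An edge is green in `τ` if it is oriented as in `τ_G`, red otherwise. -/
def greenB {n : ℕ} (τ : EdgeConfig n) (e : Edge n) : Bool := τ e == greenOrient e

def IsGreen {n : ℕ} (τ : EdgeConfig n) (e : Edge n) : Prop := τ e = greenOrient e
def IsRed {n : ℕ} (τ : EdgeConfig n) (e : Edge n) : Prop := τ e = !(greenOrient e)

/-- Incidence between edges and vertices of `Λ_n`. -/
def EdgeIncident {n : ℕ} : Edge n → Fin n × Fin n → Prop
  | Edge.horiz k j', (i, j) => j' = j ∧ (k = i.castSucc ∨ k = i.succ)
  | Edge.vert i' k, (i, j) => i' = i ∧ (k = j.castSucc ∨ k = j.succ)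

/-- Two (distinct) edges are adjacent if they share an incident `Λ_n`-vertex. -/
def EdgeAdj {n : ℕ} (e f : Edge n) : Prop :=
  e ≠ f ∧ ∃ v : Fin n × Fin n, EdgeIncident e v ∧ EdgeIncident f v

/-- A simple (self-avoiding) monochromatic path of edges of colour `g`
(`true` = green, `false` = red). -/
def MonoPath {n : ℕ} (τ : EdgeConfig n) (g : Bool) (p : List (Edge n)) : Prop :=
  p ≠ [] ∧ p.Nodup ∧ List.Chain' EdgeAdj p ∧ ∀ e ∈ p, greenB τ e = g

/-- A horizontal monochromatic bridge: a simple monochromatic path from a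
horizontal edge on the left boundary to a horizontal edge on the right
boundary of `Λ_n`. -/
def IsHorizBridge {n : ℕ} (τ : EdgeConfig n) (g : Bool) (p : List (Edge n)) : Prop :=
  MonoPath τ g p ∧ (∃ j, p.head? = some (Edge.horiz 0 j)) ∧
    (∃ j, p.getLast? = some (Edge.horiz (Fin.last n) j))

/-- A vertical monochromatic bridge, from the top boundary to the bottom. -/
def IsVertBridge {n : ℕ} (τ : EdgeConfig n) (g : Bool) (p : List (Edge n)) : Prop :=
  MonoPath τ g p ∧ (∃ i, p.head? = some (Edge.vert i (Fin.last n))) ∧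
    (∃ i, p.getLast? = some (Edge.vert i 0))

def HorizGreenBridge {n : ℕ} (τ : EdgeConfig n) : Prop := ∃ p, IsHorizBridge τ true p
def HorizRedBridge {n : ℕ} (τ : EdgeConfig n) : Prop := ∃ p, IsHorizBridge τ false p
def VertGreenBridge {n : ℕ} (τ : EdgeConfig n) : Prop := ∃ p, IsVertBridge τ true p
def VertRedBridge {n : ℕ} (τ : EdgeConfig n) : Prop := ∃ p, IsVertBridge τ false p

def HasGreenCross {n : ℕ} (τ : EdgeConfig n) : Prop :=
  HorizGreenBridge τ ∧ VertGreenBridge τ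

def HasRedCross {n : ℕ} (τ : EdgeConfig n) : Prop :=
  HorizRedBridge τ ∧ VertRedBridge τ

/-- `C_G`: the states with a green cross. -/
def CG (n : ℕ) : Set (EdgeConfig n) := {τ | IceRule τ ∧ HasGreenCross τ}

/-- `C_R`: the states with a red cross. -/
def CR (n : ℕ) : Set (EdgeConfig n) := {τ | IceRule τ ∧ HasRedCross τ}

/-! The shifted lattice `L = ℤ² + (1/2, 1/2)`, restricted to the region inside
`Λ_n`.  The `L_n`-vertex `(i, j) : Fin (n+1) × Fin (n+1)` represents the point
`(i - 1/2, j - 1/2)`; its boundary vertices are those with a coordinate equal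
to `0` or `n`.  An `L_n`-edge is a diagonal passing through exactly one
`Λ_n`-vertex; it is recorded as that `Λ_n`-vertex together with a Boolean
(`true` for the NE–SW diagonal, `false` for the NW–SE diagonal). -/
abbrev LVertex (n : ℕ) := Fin (n + 1) × Fin (n + 1)

abbrev LEdge (n : ℕ) := (Fin n × Fin n) × Bool

/-- The two `L_n`-endpoints of an `L_n`-edge. -/
def lEdgeEnds {n : ℕ} : LEdge n → LVertex n × LVertex n
  | ((i, j), true) => ((i.castSucc, j.castSucc), (i.succ, j.succ))
  | ((i, j), false) => ((i.succ, j.castSucc), (i.castSucc, j.succ))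

/-- The `L_n`-edge `e` joins the `L_n`-vertices `u` and `v`. -/
def StepOnEdge {n : ℕ} (e : LEdge n) (u v : LVertex n) : Prop :=
  lEdgeEnds e = (u, v) ∨ lEdgeEnds e = (v, u)

/-- Adjacency in the lattice `L_n`. -/
def LAdjacent {n : ℕ} (u v : LVertex n) : Prop :=
  ∃ e : LEdge n, StepOnEdge e u v

/-- Membership of an `L_n`-edge in `L_τ`: the four `Λ_n`-edges incident to the
`Λ_n`-vertex it passes through are two green and two red, and the edge
separates the two green edges from the two red ones. -/
def lTau {n : ℕ} (τ : EdgeConfig n) : LEdge n → Bool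
  | ((i, j), true) =>
      (greenB τ (leftE i j) == greenB τ (topE i j)) &&
        (greenB τ (rightE i j) == greenB τ (botE i j)) &&
        !(greenB τ (leftE i j) == greenB τ (rightE i j))
  | ((i, j), false) =>
      (greenB τ (leftE i j) == greenB τ (botE i j)) &&
        (greenB τ (rightE i j) == greenB τ (topE i j)) &&
        !(greenB τ (leftE i j) == greenB τ (rightE i j))

/-- A step between two `L_n`-vertices along an edge of `L_τ`. -/
def LStep {n : ℕ} (τ : EdgeConfig n) (u v : LVertex n) : Prop :=
  ∃ e : LEdge n, StepOnEdge e u v ∧ lTau τ e = true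

/-- The consecutive steps of a path given as a list of vertices. -/
def pathSteps {α : Type*} (p : List α) : List (α × α) := p.zip p.tail

/-- A vertical fault line: a self-avoiding path of `L_τ`-edges from an
`L_n`-vertex on the top boundary to an `L_n`-vertex on the bottom boundary. -/
def IsVertFaultLine {n : ℕ} (τ : EdgeConfig n) (p : List (LVertex n)) : Prop :=
  p ≠ [] ∧ p.Nodup ∧ List.Chain' (LStep τ) p ∧
    (∃ u, p.head? = some u ∧ u.2 = Fin.last n) ∧
    (∃ u, p.getLast? = some u ∧ u.2 = 0)

/-- A horizontal fault line: from the left boundary to the right boundary. -/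
def IsHorizFaultLine {n : ℕ} (τ : EdgeConfig n) (p : List (LVertex n)) : Prop :=
  p ≠ [] ∧ p.Nodup ∧ List.Chain' (LStep τ) p ∧
    (∃ u, p.head? = some u ∧ u.1 = 0) ∧
    (∃ u, p.getLast? = some u ∧ u.1 = Fin.last n)

def HasVertFaultLine {n : ℕ} (τ : EdgeConfig n) : Prop := ∃ p, IsVertFaultLine τ p
def HasHorizFaultLine {n : ℕ} (τ : EdgeConfig n) : Prop := ∃ p, IsHorizFaultLine τ p

/-- `C_FL`: the states with a (horizontal or vertical) fault line. -/
def CFL (n : ℕ) : Set (EdgeConfig n) :=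
  {τ | IceRule τ ∧ (HasHorizFaultLine τ ∨ HasVertFaultLine τ)}

/-- A vertical almost fault line: a self-avoiding `L_n`-path from the top
boundary to the bottom boundary all of whose edges except exactly one
belong to `L_τ`. -/
def IsVertAlmostFaultLine {n : ℕ} (τ : EdgeConfig n) (p : List (LVertex n)) : Prop :=
  p ≠ [] ∧ p.Nodup ∧ List.Chain' LAdjacent p ∧
    (∃ u, p.head? = some u ∧ u.2 = Fin.last n) ∧
    (∃ u, p.getLast? = some u ∧ u.2 = 0) ∧
    ∃ s ∈ pathSteps p, ¬ LStep τ s.1 s.2 ∧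
      ∀ t ∈ pathSteps p, t ≠ s → LStep τ t.1 t.2

/-- A horizontal almost fault line. -/
def IsHorizAlmostFaultLine {n : ℕ} (τ : EdgeConfig n) (p : List (LVertex n)) : Prop :=
  p ≠ [] ∧ p.Nodup ∧ List.Chain' LAdjacent p ∧
    (∃ u, p.head? = some u ∧ u.1 = 0) ∧
    (∃ u, p.getLast? = some u ∧ u.1 = Fin.last n) ∧
    ∃ s ∈ pathSteps p, ¬ LStep τ s.1 s.2 ∧
      ∀ t ∈ pathSteps p, t ≠ s → LStep τ t.1 t.2

/-- `C_AFL`: the states with an almost fault line. -/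
def CAFL (n : ℕ) : Set (EdgeConfig n) :=
  {τ | IceRule τ ∧
    ((∃ p, IsHorizAlmostFaultLine τ p) ∨ (∃ p, IsVertAlmostFaultLine τ p))}

/-- The weight of the vertex `(i, j)`: `c` for the two `c`-type configurations
(both horizontal edges in, or both out), and `a` or `b` for the others. -/
noncomputable def vertexWeight {n : ℕ} (a b c : ℝ) (τ : EdgeConfig n)
    (i j : Fin n) : ℝ :=
  if τ (leftE i j) ≠ τ (rightE i j) then c
  else if τ (leftE i j) = τ (botE i j) then a else b

/-- The weight `w(τ)` of a state: the product of the vertex weights. -/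
noncomputable def weight {n : ℕ} (a b c : ℝ) (τ : EdgeConfig n) : ℝ :=
  ∏ v : Fin n × Fin n, vertexWeight a b c τ v.1 v.2

/-- The partition function `Z`. -/
noncomputable def Zsum (n : ℕ) (a b c : ℝ) : ℝ :=
  ∑ τ ∈ Finset.univ.filter (fun τ : EdgeConfig n => IceRule τ), weight a b c τ

open Classical in
/-- The Gibbs measure of a set of states, `π(S) = (Σ_{τ∈S} w(τ))/Z`. -/
noncomputable def piSet (n : ℕ) (a b c : ℝ) (S : Set (EdgeConfig n)) : ℝ :=
  (∑ τ ∈ Finset.univ.filter (fun τ : EdgeConfig n => τ ∈ S), weight a b c τ) /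
    Zsum n a b c

/-- The four edges (bottom, right, top, left) of the unit square of `ℤ²`
whose lower-left corner is the `Λ_n`-vertex `(i, j)`. -/
def squareEdges (n : ℕ) (i j : ℕ) (hi : i + 1 < n) (hj : j + 1 < n) :
    Edge n × Edge n × Edge n × Edge n :=
  (Edge.horiz ⟨i + 1, by omega⟩ ⟨j, by omega⟩,
    Edge.vert ⟨i + 1, by omega⟩ ⟨j + 1, by omega⟩,
    Edge.horiz ⟨i + 1, by omega⟩ ⟨j + 1, by omega⟩,
    Edge.vert ⟨i, by omega⟩ ⟨j + 1, by omega⟩)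

/-- The four edges (bottom, right, top, left) around a unit square form a
directed cycle, i.e. are consistently oriented. -/
def DirectedSquare {n : ℕ} (τ : EdgeConfig n)
    (e : Edge n × Edge n × Edge n × Edge n) : Prop :=
  (τ e.1 = true ∧ τ e.2.1 = true ∧ τ e.2.2.1 = false ∧ τ e.2.2.2 = false) ∨
    (τ e.1 = false ∧ τ e.2.1 = false ∧ τ e.2.2.1 = true ∧ τ e.2.2.2 = true)

/-- Reversing the orientations of the four edges around a unit square. -/
def flipSquare {n : ℕ} (τ : EdgeConfig n)
    (e : Edge n × Edge n × Edge n × Edge n) : EdgeConfig n :=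
  fun f => if f = e.1 ∨ f = e.2.1 ∨ f = e.2.2.1 ∨ f = e.2.2.2 then !(τ f) else τ f

/-- A move of the Glauber dynamics `M_G` at the unit square with lower-left
corner `(i, j)`: the four edges around the square are consistently oriented
in `τ`, and `τ'` is obtained from `τ` by reversing them. -/
def GlauberMoveAt {n : ℕ} (τ τ' : EdgeConfig n) (i j : ℕ)
    (hi : i + 1 < n) (hj : j + 1 < n) : Prop :=
  DirectedSquare τ (squareEdges n i j hi hj) ∧
    τ' = flipSquare τ (squareEdges n i j hi hj)

/-- A move of the Glauber dynamics `M_G`. -/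
def GlauberMove {n : ℕ} (τ τ' : EdgeConfig n) : Prop :=
  ∃ (i j : ℕ) (hi : i + 1 < n) (hj : j + 1 < n), GlauberMoveAt τ τ' i j hi hj

/-- `∂C_G`: the states outside `C_G` that are one move of `M_G` away from
`C_G`. -/
def boundaryCG (n : ℕ) : Set (EdgeConfig n) :=
  {τ | IceRule τ ∧ τ ∉ CG n ∧ ∃ σ ∈ CG n, GlauberMove σ τ}

/-- The state space `Ω` as a type. -/
abbrev OmegaT (n : ℕ) := {τ : EdgeConfig n // IceRule τ}

open Classical in
/-- Metropolis transition rate of `M_G` between two distinct states: propose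
one of the `(n-1)²` unit squares uniformly at random and accept the flip with
probability `min 1 (w(τ')/w(τ))`. -/
noncomputable def metro {n : ℕ} (a b c : ℝ) (τ τ' : OmegaT n) : ℝ :=
  if GlauberMove τ.1 τ'.1 then
    (1 / (((n : ℝ) - 1) * ((n : ℝ) - 1))) *
      min 1 (weight a b c τ'.1 / weight a b c τ.1)
  else 0

/-- The transition matrix of the Glauber dynamics `M_G`. -/
noncomputable def transP {n : ℕ} (a b c : ℝ) (τ τ' : OmegaT n) : ℝ :=
  if τ' = τ then 1 - ∑ σ ∈ Finset.univ.erase τ, metro a b c τ σ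
  else metro a b c τ τ'

/-- The `t`-step transition probabilities of `M_G`. -/
noncomputable def transPow {n : ℕ} (a b c : ℝ) : ℕ → OmegaT n → OmegaT n → ℝ
  | 0, τ, τ' => if τ = τ' then 1 else 0
  | t + 1, τ, τ' => ∑ σ : OmegaT n, transPow a b c t τ σ * transP a b c σ τ'

/-- The stationary Gibbs distribution `π` on `Ω`. -/
noncomputable def piDist {n : ℕ} (a b c : ℝ) (τ : OmegaT n) : ℝ :=
  weight a b c τ.1 / Zsum n a b c

/-- Total variation distance between two distributions on `Ω`. -/
noncomputable def tvDist {n : ℕ} (μ ν : OmegaT n → ℝ) : ℝ :=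
  (∑ τ : OmegaT n, |μ τ - ν τ|) / 2

/-- The mixing time of `M_G`: the smallest `t` after which the total variation
distance to `π` is at most `1/4` from any starting state. -/
noncomputable def mixingTime (n : ℕ) (a b c : ℝ) : ℕ :=
  sInf {t : ℕ | ∀ τ₀ : OmegaT n,
    tvDist (transPow a b c t τ₀) (piDist a b c) ≤ 1 / 4}

/-- The number of green edges incident to the vertex `(i, j)` in `τ`. -/
def greenCountAt {n : ℕ} (τ : EdgeConfig n) (i j : Fin n) : ℕ :=
  (cond (greenB τ (leftE i j)) 1 0) + (cond (greenB τ (rightE i j)) 1 0) +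
    (cond (greenB τ (botE i j)) 1 0) + (cond (greenB τ (topE i j)) 1 0)

/-- The number of `L_τ`-edges incident to the `L_n`-vertex `u`. -/
def lTauDegree {n : ℕ} (τ : EdgeConfig n) (u : LVertex n) : ℕ :=
  (Finset.univ.filter (fun e : LEdge n =>
    lTau τ e = true ∧ ((lEdgeEnds e).1 = u ∨ (lEdgeEnds e).2 = u))).card

/-- The number of colour changes encountered when going rotationally
(bottom, right, top, left) around the four `Λ_n`-edges surrounding the
internal `L_n`-vertex `(i, j)` (representing the point `(i - 1/2, j - 1/2)`). -/
def colorChangesAround (n : ℕ) (τ : EdgeConfig n) (i j : ℕ)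
    (hi0 : 0 < i) (hin : i < n) (hj0 : 0 < j) (hjn : j < n) : ℕ :=
  let bo := greenB τ (Edge.horiz ⟨i, by omega⟩ ⟨j - 1, by omega⟩)
  let t := greenB τ (Edge.horiz ⟨i, by omega⟩ ⟨j, by omega⟩)
  let l := greenB τ (Edge.vert ⟨i - 1, by omega⟩ ⟨j, by omega⟩)
  let r := greenB τ (Edge.vert ⟨i, by omega⟩ ⟨j, by omega⟩)
  (cond (bo != r) 1 0) + (cond (r != t) 1 0) +
    (cond (t != l) 1 0) + (cond (l != bo) 1 0)


theorem exists_nodup_isChain_of_reflTransGen {α : Type*} {r : α → α → Prop} {a b : α}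
    (h : Relation.ReflTransGen r a b) :
    ∃ p : List α, p.Nodup ∧ p.IsChain r ∧ p.head? = some a ∧ p.getLast? = some b ∧
      ∀ x ∈ p, Relation.ReflTransGen r a x ∧ Relation.ReflTransGen r x b := by
  induction h using Relation.ReflTransGen.head_induction_on with
  | refl => exact ⟨[b], by simp, by simp, by simp, by simp, by simp [Relation.ReflTransGen.refl]⟩
  | @head a c hac hcb ih =>
    obtain ⟨p, hnd, hch, hhd, hlast, hmem⟩ := ih
    by_cases hap : a ∈ p
    · obtain ⟨l₁, l₂, rfl⟩ := List.append_of_mem hap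
      refine ⟨a :: l₂, (List.nodup_append.1 hnd).2.1, (List.isChain_append.1 hch).2.1, rfl, ?_,
        fun x hx => ?_⟩
      · rw [← hlast, List.getLast?_append_of_ne_nil _ (by simp)]
      · have := hmem x (List.mem_append_right _ hx)
        exact ⟨.head hac this.1, this.2⟩
    · cases p with
      | nil => simp at hhd
      | cons d p =>
        obtain rfl : d = c := by simpa using hhd
        refine ⟨a :: d :: p, List.nodup_cons.2 ⟨hap, hnd⟩, List.isChain_cons_cons.2 ⟨hac, hch⟩,
          rfl, ?_, fun x hx => ?_⟩
        · simpa [List.getLast?_cons_cons] using hlast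
        · rcases List.mem_cons.1 hx with rfl | hx
          · exact ⟨.refl, .head hac hcb⟩
          · exact ⟨.head hac (hmem x hx).1, (hmem x hx).2⟩

theorem List.IsChain.forall_of_head {α : Type*} {r : α → α → Prop} {P : α → Prop} :
    ∀ {p : List α} {a : α}, p.IsChain r → p.head? = some a → P a →
      (∀ x ∈ p, ∀ y ∈ p, r x y → P x → P y) → ∀ x ∈ p, P x
  | [], _, _, h, _, _ => by simp at h
  | [b], a, _, h, ha, _ => by
    obtain rfl : b = a := by simpa using h
    simpa using ha
  | b :: c :: p, a, hch, h, ha, hstep => by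
    obtain rfl : b = a := by simpa using h
    rw [List.isChain_cons_cons] at hch
    have hc : P c := hstep b (by simp) c (by simp) hch.1 ha
    have := List.IsChain.forall_of_head hch.2 rfl hc
      (fun x hx y hy => hstep x (List.mem_cons_of_mem _ hx) y (List.mem_cons_of_mem _ hy))
    intro x hx
    rcases List.mem_cons.1 hx with rfl | hx
    exacts [ha, this x hx]

theorem List.IsChain.rel_of_mem_pathSteps {α : Type*} {r : α → α → Prop} :
    ∀ {p : List α}, p.IsChain r → ∀ {t : α × α}, t ∈ pathSteps p → r t.1 t.2
  | [], _, _, ht => by simp [pathSteps] at ht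
  | [a], _, _, ht => by simp [pathSteps] at ht
  | a :: b :: p, hp, t, ht => by
    rw [List.isChain_cons_cons] at hp
    simp only [pathSteps, List.tail_cons, List.zip_cons_cons, List.mem_cons] at ht
    rcases ht with rfl | ht
    · exact hp.1
    · exact hp.2.rel_of_mem_pathSteps (by simpa [pathSteps] using ht)

theorem pathSteps_append_cases {α : Type*} {r : α → α → Prop} {x y : α} :
    ∀ {p q : List α}, p.IsChain r → q.IsChain r → p.getLast? = some x → q.head? = some y →
      (x, y) ∈ pathSteps (p ++ q) ∧ ∀ t ∈ pathSteps (p ++ q), t ≠ (x, y) → r t.1 t.2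
  | [], _, _, _, h, _ => by simp at h
  | [a], [], _, _, _, h => by simp at h
  | [a], b :: q, _, hq, hx, hy => by
    obtain rfl : a = x := by simpa using hx
    obtain rfl : b = y := by simpa using hy
    refine ⟨by simp [pathSteps], fun t ht hne => ?_⟩
    have ht' : t ∈ pathSteps (b :: q) := by
      simpa [pathSteps, hne] using ht
    exact hq.rel_of_mem_pathSteps ht'
  | a :: b :: p, q, hp, hq, hx, hy => by
    rw [List.isChain_cons_cons] at hp
    have ih := pathSteps_append_cases hp.2 hq (by simpa [List.getLast?_cons_cons] using hx) hy
    refine ⟨?_, fun t ht hne => ?_⟩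
    · have := ih.1
      simp only [pathSteps, List.cons_append, List.tail_cons, List.zip_cons_cons] at this ⊢
      exact List.mem_cons_of_mem _ this
    · simp only [pathSteps, List.cons_append, List.tail_cons, List.zip_cons_cons,
        List.mem_cons] at ht
      rcases ht with rfl | ht
      · exact hp.1
      · exact ih.2 t (by simpa [pathSteps] using ht) hne

theorem edgeIncident_iff {n : ℕ} (e : Edge n) (i j : Fin n) :
    EdgeIncident e (i, j) ↔ e = leftE i j ∨ e = rightE i j ∨ e = botE i j ∨ e = topE i j := by
  cases e <;> simp [EdgeIncident, leftE, rightE, botE, topE] <;> tauto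

theorem EdgeAdj.symm {n : ℕ} {e f : Edge n} (h : EdgeAdj e f) : EdgeAdj f e :=
  ⟨h.1.symm, h.2.imp fun _ hv => hv.symm⟩

/-- The four values of `c` around every vertex are either all equal, or are separated into two
equal pairs by one of the two diagonals, on which moreover `d` holds. -/
def SplitsAlong {n : ℕ} {α : Type*} (c : Edge n → α) (d : LEdge n → Prop) : Prop :=
  ∀ i j : Fin n,
    (c (leftE i j) = c (rightE i j) ∧ c (leftE i j) = c (topE i j) ∧
      c (leftE i j) = c (botE i j)) ∨
    (c (leftE i j) = c (topE i j) ∧ c (rightE i j) = c (botE i j) ∧ d ((i, j), true)) ∨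
    (c (leftE i j) = c (botE i j) ∧ c (rightE i j) = c (topE i j) ∧ d ((i, j), false))

theorem IceRule.splitsAlong {n : ℕ} {τ : EdgeConfig n} (h : IceRule τ) :
    SplitsAlong (greenB τ) (fun e => lTau τ e = true) := by
  intro i j
  have h := h i j
  have h1 : (i.val + j.val) % 2 = 0 ∨ (i.val + j.val) % 2 = 1 := by omega
  simp only [inDegree] at h
  simp only [lTau, greenB, leftE, rightE, botE, topE, greenOrient, Fin.val_castSucc,
    Fin.val_succ] at *
  have h2 : (i.val + (j.val + 1)) % 2 = 1 - (i.val + j.val) % 2 := by omega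
  have h3 : (i.val + 1 + j.val) % 2 = 1 - (i.val + j.val) % 2 := by omega
  rw [h2, h3]
  generalize τ (Edge.horiz i.castSucc j) = l at *
  generalize τ (Edge.horiz i.succ j) = r at *
  generalize τ (Edge.vert i j.castSucc) = b at *
  generalize τ (Edge.vert i j.succ) = t at *
  rcases h1 with h1 | h1 <;> rw [h1] <;> revert h <;> revert l r b t <;> decide

theorem Fin.sum_castSucc_add_succ {n : ℕ} (F : Fin (n + 1) → ZMod 2) :
    ∑ i : Fin n, (F i.castSucc + F i.succ) = F 0 + F (Fin.last n) := by
  have h1 := Fin.sum_univ_castSucc F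
  have h2 := Fin.sum_univ_succ F
  rw [h1] at h2
  clear h1
  rw [Finset.sum_add_distrib]
  generalize ∑ i : Fin n, F i.castSucc = x at *
  generalize ∑ i : Fin n, F i.succ = y at *
  generalize F 0 = a at *
  generalize F (Fin.last n) = b at *
  revert x y a b; decide

theorem exists_horiz_crossing {n : ℕ} {α : Type*} {c : Edge n → α} {s : LVertex n → Prop}
    (hc : SplitsAlong c fun e => (s (lEdgeEnds e).1 ↔ s (lEdgeEnds e).2))
    (htop : ∀ i, s (i, Fin.last n)) (hbot : ∀ i, ¬ s (i, 0)) :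
    ∃ j j' : Fin n, Relation.ReflTransGen (fun e f => EdgeAdj e f ∧ c e = c f)
      (Edge.horiz 0 j) (Edge.horiz (Fin.last n) j') := by
  classical
  by_contra! hno
  set B : Edge n → Prop := fun e => ∃ j, Relation.ReflTransGen
    (fun e f => EdgeAdj e f ∧ c e = c f) (Edge.horiz 0 j) e with hB
  have hBl : ∀ j, B (Edge.horiz 0 j) := fun j => ⟨j, .refl⟩
  have hBr : ∀ j, ¬ B (Edge.horiz (Fin.last n) j) := fun j ⟨j', h⟩ => hno j' j h
  have hstep : ∀ (i j : Fin n) (e f : Edge n), EdgeIncident e (i, j) → EdgeIncident f (i, j) →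
      c e = c f → (B e ↔ B f) := by
    intro i j e f he hf hef
    by_cases h : e = f
    · rw [h]
    · have hadj : EdgeAdj e f := ⟨h, (i, j), he, hf⟩
      exact ⟨fun ⟨k, hk⟩ => ⟨k, hk.tail ⟨hadj, hef⟩⟩,
        fun ⟨k, hk⟩ => ⟨k, hk.tail ⟨hadj.symm, hef.symm⟩⟩⟩
  let β : Edge n → ZMod 2 := fun e => if B e then 1 else 0
  let σ : LVertex n → ZMod 2 := fun u => if s u then 1 else 0
  have hβ : ∀ {e f}, (B e ↔ B f) → β e = β f := fun h => by simp only [β, h]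
  have hσ : ∀ {u v}, (s u ↔ s v) → σ u = σ v := fun h => by simp only [σ, h]
  let H : Fin (n + 1) → Fin n → ZMod 2 := fun k j =>
    β (Edge.horiz k j) * (σ (k, j.castSucc) + σ (k, j.succ))
  let V : Fin n → Fin (n + 1) → ZMod 2 := fun i k =>
    β (Edge.vert i k) * (σ (i.castSucc, k) + σ (i.succ, k))
  have hvertex : ∀ i j : Fin n,
      (H i.castSucc j + H i.succ j) + (V i j.castSucc + V i j.succ) = 0 := by
    intro i j
    have hl := (edgeIncident_iff (leftE i j) i j).2 (by simp)
    have hr := (edgeIncident_iff (rightE i j) i j).2 (by simp)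
    have hb := (edgeIncident_iff (botE i j) i j).2 (by simp)
    have ht := (edgeIncident_iff (topE i j) i j).2 (by simp)
    have key : ∀ l r b t p q u v : ZMod 2,
        ((l = r ∧ l = t ∧ l = b) ∨ (l = t ∧ r = b ∧ p = v) ∨ (l = b ∧ r = t ∧ q = u)) →
        (l * (p + u) + r * (q + v)) + (b * (p + q) + t * (u + v)) = 0 := by decide
    apply key
    rcases hc i j with ⟨h1, h2, h3⟩ | ⟨h1, h2, h3⟩ | ⟨h1, h2, h3⟩
    · exact .inl ⟨hβ (hstep i j _ _ hl hr h1), hβ (hstep i j _ _ hl ht h2),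
        hβ (hstep i j _ _ hl hb h3)⟩
    · exact .inr (.inl ⟨hβ (hstep i j _ _ hl ht h1), hβ (hstep i j _ _ hr hb h2), hσ h3⟩)
    · exact .inr (.inr ⟨hβ (hstep i j _ _ hl hb h1), hβ (hstep i j _ _ hr ht h2), hσ h3⟩)
  have htotal : ∑ j : Fin n, ∑ i : Fin n, (H i.castSucc j + H i.succ j) +
      ∑ i : Fin n, ∑ j : Fin n, (V i j.castSucc + V i j.succ) = 0 := by
    rw [Finset.sum_comm, ← Finset.sum_add_distrib]
    exact Finset.sum_eq_zero fun i _ => by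
      rw [← Finset.sum_add_distrib]
      exact Finset.sum_eq_zero fun j _ => hvertex i j
  have hVz : ∀ i : Fin n, ∑ j : Fin n, (V i j.castSucc + V i j.succ) = 0 := fun i => by
    rw [Fin.sum_castSucc_add_succ (V i)]
    simp [V, σ, htop, hbot, CharTwo.add_self_eq_zero]
  have hHz : ∀ j : Fin n, ∑ i : Fin n, (H i.castSucc j + H i.succ j) =
      σ (0, j.castSucc) + σ (0, j.succ) := fun j => by
    rw [Fin.sum_castSucc_add_succ (fun k => H k j)]
    simp [H, β, hBl, hBr]
  rw [Finset.sum_congr rfl fun j _ => hHz j, Finset.sum_congr rfl fun i _ => hVz i,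
    Fin.sum_castSucc_add_succ (fun k => σ (0, k))] at htotal
  simp [σ, htop, hbot] at htotal

theorem exists_vert_crossing {n : ℕ} {α : Type*} {c : Edge n → α} {s : LVertex n → Prop}
    (hc : SplitsAlong c fun e => (s (lEdgeEnds e).1 ↔ s (lEdgeEnds e).2))
    (hleft : ∀ j, s (0, j)) (hright : ∀ j, ¬ s (Fin.last n, j)) :
    ∃ i i' : Fin n, Relation.ReflTransGen (fun e f => EdgeAdj e f ∧ c e = c f)
      (Edge.vert i (Fin.last n)) (Edge.vert i' 0) := by
  let ρ : Edge n → Edge n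
    | Edge.horiz k j => Edge.vert j k
    | Edge.vert i k => Edge.horiz k i
  have hinc : ∀ e (v : Fin n × Fin n), EdgeIncident e v → EdgeIncident (ρ e) v.swap := by
    rintro (⟨k, j⟩ | ⟨i, k⟩) ⟨a, b⟩ h <;> exact h
  have hρ : ∀ e, ρ (ρ e) = e := by rintro (⟨k, j⟩ | ⟨i, k⟩) <;> rfl
  have hadj : ∀ e f, EdgeAdj e f → EdgeAdj (ρ e) (ρ f) := by
    rintro e f ⟨hne, v, he, hf⟩
    exact ⟨fun h => hne (by rw [← hρ e, h, hρ]), v.swap, hinc e v he, hinc f v hf⟩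
  obtain ⟨j, j', h⟩ := exists_horiz_crossing (c := fun e => c (ρ e))
    (s := fun u => ¬ s u.swap) (fun i j => by
      rcases hc j i with ⟨h1, h2, h3⟩ | ⟨h1, h2, h3⟩ | ⟨h1, h2, h3⟩
      · exact .inl ⟨h3.symm.trans h2, h3.symm.trans h1, h3.symm⟩
      · exact .inr (.inl ⟨h2.symm, h1.symm, not_congr h3⟩)
      · exact .inr (.inr ⟨h1.symm, h2.symm, not_congr h3.symm⟩)) hright
    (fun i => by simpa using hleft i)
  refine ⟨j', j, ?_⟩
  have := h.lift (p := fun e f => EdgeAdj f e ∧ c f = c e) ρ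
    (fun e f hef => ⟨(hadj e f hef.1).symm, hef.2.symm⟩)
  exact Relation.reflTransGen_swap.1 this

theorem exists_chain_of_path_from_top {n : ℕ} {P : Edge n → Prop} {i₀ : Fin n} {p : List (Edge n)}
    (hp : p.IsChain EdgeAdj) (hP : ∀ e ∈ p, P e) (hhd : p.head? = some (Edge.vert i₀ (Fin.last n))) :
    ∀ e ∈ p, ∀ v, EdgeIncident e v → ∃ Q : Edge n → ZMod 2,
      (∀ e, ¬ P e → Q e = 0) ∧ (∀ j, Q (Edge.horiz 0 j) = 0) ∧
      (∀ j, Q (Edge.horiz (Fin.last n) j) = 0) ∧ (∀ i, Q (Edge.vert i 0) = 0) ∧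
      ∑ i, Q (Edge.vert i (Fin.last n)) = 1 ∧
      ∀ i j : Fin n, Q (leftE i j) + Q (rightE i j) + Q (botE i j) + Q (topE i j) =
        if (i, j) = v then 1 else 0 := by
  refine hp.forall_of_head hhd ?_ ?_
  · have h0 : P (Edge.vert i₀ (Fin.last n)) := hP _ (List.mem_of_head? hhd)
    rintro ⟨i, j⟩ hv
    have hn : (0 : Fin (n + 1)) ≠ Fin.last n := by
      have := i.pos
      rw [Ne, Fin.ext_iff]; simp; omega
    obtain ⟨rfl, hv⟩ := hv
    have hj : Fin.last n = j.succ := hv.resolve_left fun h => (Fin.castSucc_ne_last j) h.symm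
    refine ⟨Pi.single (Edge.vert i₀ (Fin.last n)) 1, fun e he => ?_, ?_, ?_, ?_, ?_, ?_⟩
    · exact Pi.single_eq_of_ne (by rintro rfl; exact he h0) _
    · simp
    · simp
    · simp [hn]
    · simp [Pi.single_apply]
    · intro a b
      have hb : b.castSucc ≠ Fin.last n := Fin.castSucc_ne_last b
      have hb' : b.succ = Fin.last n ↔ b = j := by rw [hj, Fin.succ_inj]
      simp [Pi.single_apply, leftE, rightE, botE, topE, hb, hb']
  · rintro e he f hf ⟨hne, v, hev, hfv⟩ ih w hfw
    by_cases hvw : v = w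
    · exact ih w (hvw ▸ hev)
    obtain ⟨Q, h1, h2, h3, h4, h5, h6⟩ := ih v hev
    have hfP := hP f hf
    refine ⟨Q + Pi.single f 1, fun e he => ?_, ?_⟩
    · have : e ≠ f := by rintro rfl; exact he hfP
      simp [h1 e he, this]
    obtain ⟨a, b⟩ := v
    obtain ⟨a', b'⟩ := w
    have hlift : (∀ i j : Fin n,
        (Pi.single f 1 : Edge n → ZMod 2) (leftE i j) + (Pi.single f 1 : Edge n → ZMod 2) (rightE i j)
          + (Pi.single f 1 : Edge n → ZMod 2) (botE i j)
          + (Pi.single f 1 : Edge n → ZMod 2) (topE i j) =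
        (if (i, j) = (a, b) then 1 else 0) + if (i, j) = (a', b') then 1 else 0) →
        ∀ i j : Fin n, (Q + Pi.single f 1 : Edge n → ZMod 2) (leftE i j) + (Q + Pi.single f 1 : Edge n → ZMod 2) (rightE i j) +
          (Q + Pi.single f 1 : Edge n → ZMod 2) (botE i j) + (Q + Pi.single f 1 : Edge n → ZMod 2) (topE i j) =
          if (i, j) = (a', b') then 1 else 0 := by
      intro h i j
      have h := congrArg₂ (· + ·) (h6 i j) (h i j)
      simp only [← add_assoc, CharTwo.add_self_eq_zero, zero_add] at h
      rw [← h]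
      simp only [Pi.add_apply]
      ring
    cases f with
    | horiz k l =>
      obtain ⟨rfl, hk⟩ := hfv
      obtain ⟨rfl, hk'⟩ := hfw
      have hk : k = a.succ ∧ k = a'.castSucc ∨ k = a'.succ ∧ k = a.castSucc := by
        rcases hk with rfl | rfl <;> rcases hk' with hk' | hk' <;> simp_all
      have hk0 : k ≠ 0 ∧ k ≠ Fin.last n := by
        rcases hk with ⟨h, h'⟩ | ⟨h, h'⟩ <;>
          exact ⟨h ▸ Fin.succ_ne_zero _, h' ▸ Fin.castSucc_ne_last _⟩
      refine ⟨by simp [h2, hk0.1.symm], by simp [h3, hk0.2.symm],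
        by simp [h4], by simp [h5], hlift fun i j => ?_⟩
      have hi : (i.castSucc = k ↔ i = a') ∧ (i.succ = k ↔ i = a) ∨
          (i.castSucc = k ↔ i = a) ∧ (i.succ = k ↔ i = a') := by
        rcases hk with ⟨h, h'⟩ | ⟨h, h'⟩
        · exact .inl ⟨by rw [h', Fin.castSucc_inj], by rw [h, Fin.succ_inj]⟩
        · exact .inr ⟨by rw [h', Fin.castSucc_inj], by rw [h, Fin.succ_inj]⟩
      rcases hi with ⟨h, h'⟩ | ⟨h, h'⟩ <;>
        simp [Pi.single_apply, leftE, rightE, botE, topE, h, h', add_comm]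
    | vert l k =>
      obtain ⟨rfl, hk⟩ := hfv
      obtain ⟨rfl, hk'⟩ := hfw
      have hk : k = b.succ ∧ k = b'.castSucc ∨ k = b'.succ ∧ k = b.castSucc := by
        rcases hk with rfl | rfl <;> rcases hk' with hk' | hk' <;> simp_all
      have hk0 : k ≠ 0 ∧ k ≠ Fin.last n := by
        rcases hk with ⟨h, h'⟩ | ⟨h, h'⟩ <;>
          exact ⟨h ▸ Fin.succ_ne_zero _, h' ▸ Fin.castSucc_ne_last _⟩
      refine ⟨by simp [h2], by simp [h3], by simp [h4, hk0.1.symm],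
        by simp [h5, hk0.2.symm], hlift fun i j => ?_⟩
      have hj : (j.castSucc = k ↔ j = b') ∧ (j.succ = k ↔ j = b) ∨
          (j.castSucc = k ↔ j = b) ∧ (j.succ = k ↔ j = b') := by
        rcases hk with ⟨h, h'⟩ | ⟨h, h'⟩
        · exact .inl ⟨by rw [h', Fin.castSucc_inj], by rw [h, Fin.succ_inj]⟩
        · exact .inr ⟨by rw [h', Fin.castSucc_inj], by rw [h, Fin.succ_inj]⟩
      rcases hj with ⟨h, h'⟩ | ⟨h, h'⟩ <;>
        simp [Pi.single_apply, leftE, rightE, botE, topE, h, h', add_comm]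

theorem not_horizBridge_of_vertBridge {n : ℕ} {τ : EdgeConfig n} (hτ : IceRule τ) {g g' : Bool}
    (hg : g ≠ g') {p q : List (Edge n)} (hp : IsHorizBridge τ g p) (hq : IsVertBridge τ g' q) :
    False := by
  obtain ⟨⟨-, -, hqc, hqm⟩, ⟨i₀, hq0⟩, i₁, hq1⟩ := hq
  obtain ⟨⟨-, -, hpc, hpm⟩, ⟨j₀, hp0⟩, j₁, hp1⟩ := hp
  obtain ⟨Q, hQ⟩ : ∃ Q : Edge n → ZMod 2,
      (∀ e, greenB τ e ≠ g' → Q e = 0) ∧ (∀ j, Q (Edge.horiz 0 j) = 0) ∧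
      (∀ j, Q (Edge.horiz (Fin.last n) j) = 0) ∧
      ∑ i, Q (Edge.vert i (Fin.last n)) = 1 ∧
      ∀ i j : Fin n, Q (leftE i j) + Q (rightE i j) + Q (botE i j) + Q (topE i j) = 0 := by
    have hz : (⟨0, i₁.pos⟩ : Fin n).castSucc = 0 := rfl
    have hn : (0 : Fin (n + 1)) ≠ Fin.last n := by
      have := i₁.pos
      rw [Ne, Fin.ext_iff]; simp; omega
    obtain ⟨Q, h1, h2, h3, h4, h5, h6⟩ := exists_chain_of_path_from_top hqc hqm hq0 _
      (List.mem_of_getLast? hq1) (i₁, ⟨0, i₁.pos⟩) ⟨rfl, .inl hz.symm⟩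
    refine ⟨Q + Pi.single (Edge.vert i₁ 0) 1, fun e he => ?_, ?_, ?_, ?_, fun i j => ?_⟩
    · have : e ≠ Edge.vert i₁ 0 := by
        rintro rfl; exact he (hqm _ (List.mem_of_getLast? hq1))
      simp [h1 e he, this]
    · simp [h2]
    · simp [h3]
    · simp [h5, hn.symm]
    · have hj : j.castSucc = 0 ↔ j = ⟨0, i₁.pos⟩ := by simp [Fin.ext_iff]
      have hj' : j.succ ≠ 0 := Fin.succ_ne_zero j
      have := h6 i j
      simp only [leftE, rightE, botE, topE, Pi.add_apply, Pi.single_apply, Edge.vert.injEq, hj, hj',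
        and_false, if_false, add_zero, reduceCtorEq, Prod.mk.injEq] at this ⊢
      rw [← add_assoc, add_right_comm, this]
      exact CharTwo.add_self_eq_zero _
  obtain ⟨hQg, hQl, hQr, hQt, hQv⟩ := hQ
  let φ : Fin (n + 1) → Fin (n + 1) → ZMod 2 := fun i j =>
    ∑ i' : Fin n, if i'.castSucc < i then Q (Edge.vert i' j) else 0
  have hφ0 : ∀ j, φ 0 j = 0 := fun j => by simp [φ]
  have hφs : ∀ (i : Fin n) j, φ i.succ j = φ i.castSucc j + Q (Edge.vert i j) := by
    intro i j
    have : Q (Edge.vert i j) = ∑ i' : Fin n, if i' = i then Q (Edge.vert i' j) else 0 := by simp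
    simp only [φ]
    rw [this, ← Finset.sum_add_distrib]
    refine Finset.sum_congr rfl fun i' _ => ?_
    rcases lt_trichotomy i' i with h | rfl | h
    · simp [Fin.lt_def, Nat.lt_succ_of_lt h, h, h.ne]
    · simp [Fin.lt_def]
    · have h' : ¬ i'.val < i.val + 1 := by have := Fin.lt_def.1 h; omega
      simp [Fin.lt_def, h', h.ne', not_lt.2 (Fin.lt_def.1 h).le]
  have hφh : ∀ (j : Fin n) i, φ i j.succ = φ i j.castSucc + Q (Edge.horiz i j) := by
    intro j i
    induction i using Fin.induction with
    | zero => simp [hφ0, hQl]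
    | succ i ih =>
      rw [hφs, hφs, ih]
      have := hQv i j
      simp only [leftE, rightE, botE, topE] at this
      generalize φ i.castSucc j.castSucc = x at *
      generalize Q (Edge.horiz i.castSucc j) = l at *
      generalize Q (Edge.horiz i.succ j) = r at *
      generalize Q (Edge.vert i j.castSucc) = b at *
      generalize Q (Edge.vert i j.succ) = t at *
      clear ih
      revert x l r b t; decide
  have hφr : ∀ j, φ (Fin.last n) j = 1 := by
    intro j
    induction j using Fin.reverseInduction with
    | last => simpa [φ, Fin.castSucc_lt_last] using hQt
    | cast j ih => rw [← ih, hφh, hQr, add_zero]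
  have hzero : ∀ e, greenB τ e = g → Q e = 0 := fun e he => hQg e (by rw [he]; exact hg)
  let side : Edge n → ZMod 2 := fun e => match e with
    | Edge.horiz k j => φ k j.castSucc
    | Edge.vert i k => φ i.castSucc k
  have hside : ∀ e ∈ p, side e = 0 := by
    refine List.IsChain.forall_of_head hpc hp0 (hφ0 _) ?_
    rintro e he f hf ⟨-, ⟨i, j⟩, hei, hfi⟩ h
    have heg := hpm e he
    have hfg := hpm f hf
    rw [edgeIncident_iff] at hei hfi
    have hl : side (leftE i j) = φ i.castSucc j.castSucc := rfl
    have hr : side (rightE i j) = φ i.succ j.castSucc := rfl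
    have hb : side (botE i j) = φ i.castSucc j.castSucc := rfl
    have ht : side (topE i j) = φ i.castSucc j.succ := rfl
    have hl' : greenB τ (leftE i j) = g → φ i.castSucc j.succ = φ i.castSucc j.castSucc :=
      fun h => by rw [hφh, ← leftE, hzero _ h, add_zero]
    have hr' : greenB τ (rightE i j) = g → φ i.succ j.succ = φ i.succ j.castSucc :=
      fun h => by rw [hφh, ← rightE, hzero _ h, add_zero]
    have hb' : greenB τ (botE i j) = g → φ i.succ j.castSucc = φ i.castSucc j.castSucc :=
      fun h => by rw [hφs, ← botE, hzero _ h, add_zero]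
    have ht' : greenB τ (topE i j) = g → φ i.succ j.succ = φ i.castSucc j.succ :=
      fun h => by rw [hφs, ← topE, hzero _ h, add_zero]
    have := hτ.splitsAlong i j
    rcases hei with rfl | rfl | rfl | rfl <;> rcases hfi with rfl | rfl | rfl | rfl <;> grind
  have := hside _ (List.mem_of_getLast? hp1)
  simp [side, hφr] at this

theorem LAdjacent.symm {n : ℕ} {u v : LVertex n} (h : LAdjacent u v) : LAdjacent v u :=
  h.imp fun _ he => he.symm

theorem LStep.symm {n : ℕ} {τ : EdgeConfig n} {u v : LVertex n} (h : LStep τ u v) : LStep τ v u :=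
  h.imp fun _ he => ⟨he.1.symm, he.2⟩

theorem LStep.lAdjacent {n : ℕ} {τ : EdgeConfig n} {u v : LVertex n} (h : LStep τ u v) :
    LAdjacent u v :=
  h.imp fun _ he => he.1

/-- The edges around the unit square with lower-left corner `(i, j)`. -/
def InSquare {n : ℕ} (i j : ℕ) : Edge n → Prop
  | Edge.horiz k l => k.val = i + 1 ∧ (l.val = j ∨ l.val = j + 1)
  | Edge.vert k l => (k.val = i ∨ k.val = i + 1) ∧ l.val = j + 1

theorem inSquare_iff {n i j : ℕ} (hi : i + 1 < n) (hj : j + 1 < n) (e : Edge n) :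
    InSquare i j e ↔ e = (squareEdges n i j hi hj).1 ∨ e = (squareEdges n i j hi hj).2.1 ∨
      e = (squareEdges n i j hi hj).2.2.1 ∨ e = (squareEdges n i j hi hj).2.2.2 := by
  cases e <;> simp [InSquare, squareEdges, Fin.ext_iff] <;> omega

/-- The diagonals through the corners of the unit square with lower-left corner `(i, j)` that do
not enter the square. -/
def CutsCorner {n : ℕ} (i j : ℕ) (e : LEdge n) : Prop :=
  (e.1.1.val = i ∨ e.1.1.val = i + 1) ∧ (e.1.2.val = j ∨ e.1.2.val = j + 1) ∧
    (e.2 = false ↔ (e.1.1.val = i ↔ e.1.2.val = j))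

theorem splitsAlong_greenB_inSquare {n : ℕ} {τ : EdgeConfig n} (hτ : IceRule τ) {i j : ℕ}
    (hred : ∀ e, InSquare i j e → greenB τ e = false) :
    SplitsAlong (fun e => (greenB τ e, InSquare i j e))
      fun e => lTau τ e = true ∨ CutsCorner i j e := by
  intro a b
  have h := hτ.splitsAlong a b
  have hl := hred (leftE a b)
  have hr := hred (rightE a b)
  have hb := hred (botE a b)
  have ht := hred (topE a b)
  simp only [Prod.mk.injEq, eq_iff_iff, CutsCorner]
  generalize greenB τ (leftE a b) = l at *
  generalize greenB τ (rightE a b) = r at *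
  generalize greenB τ (botE a b) = d at *
  generalize greenB τ (topE a b) = t at *
  simp only [leftE, rightE, botE, topE, InSquare, Fin.val_castSucc, Fin.val_succ] at *
  have ha : a.val = i ∨ a.val = i + 1 ∨ (a.val ≠ i ∧ a.val ≠ i + 1 ∧ a.val + 1 ≠ i + 1) := by omega
  have hb' : b.val = j ∨ b.val = j + 1 ∨ (b.val ≠ j ∧ b.val ≠ j + 1 ∧ b.val + 1 ≠ j + 1) := by
    omega
  rcases ha with ha | ha | ha <;> rcases hb' with hb' | hb' | hb' <;>
    simp only [ha, hb'] at * <;> simp at * <;> grind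

theorem exists_lTau_cutsCorner {n : ℕ} {σ τ : EdgeConfig n} (hτ : IceRule τ) {i j : ℕ}
    (hred : ∀ e, InSquare i j e → greenB τ e = false)
    (hout : ∀ e, ¬ InSquare i j e → greenB σ e = greenB τ e) {p : List (Edge n)}
    (hp : MonoPath σ true p) {e₀ : Edge n} (he₀ : p.head? = some e₀) (hin : ¬ InSquare i j e₀)
    (hpτ : ¬ MonoPath τ true p) : ∃ e, lTau τ e = true ∧ CutsCorner i j e := by
  by_contra! hno
  obtain ⟨h1, h2, h3, h4⟩ := hp
  have hall := List.IsChain.forall_of_head (P := fun e => ¬ InSquare i j e) h3 he₀ hin (by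
    rintro e he f hf ⟨-, ⟨a, b⟩, hev, hfv⟩ hine hinf
    have heg : greenB τ e = true := hout e hine ▸ h4 e he
    have hfg := hred f hinf
    rw [edgeIncident_iff] at hev hfv
    have h := hτ.splitsAlong a b
    have h' := hno ((a, b), true)
    have h'' := hno ((a, b), false)
    simp only [CutsCorner] at h' h''
    rcases hev with rfl | rfl | rfl | rfl <;> rcases hfv with rfl | rfl | rfl | rfl <;>
      simp only [leftE, rightE, botE, topE, InSquare, Fin.val_castSucc, Fin.val_succ] at * <;>
      grind)
  exact hpτ ⟨h1, h2, h3, fun e he => hout e (hall e he) ▸ h4 e he⟩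

theorem exists_almost_path {n : ℕ} {τ : EdgeConfig n} {P Q : LVertex n → Prop}
    (hFL : ¬ ∃ p : List (LVertex n), p ≠ [] ∧ p.Nodup ∧ p.IsChain (LStep τ) ∧
      (∃ u, p.head? = some u ∧ P u) ∧ (∃ u, p.getLast? = some u ∧ Q u))
    {u x y v : LVertex n} (hu : P u) (hv : Q v) (hux : Relation.ReflTransGen (LStep τ) u x)
    (hxy : x = y ∨ LAdjacent x y) (hyv : Relation.ReflTransGen (LStep τ) y v) :
    ∃ p : List (LVertex n), p ≠ [] ∧ p.Nodup ∧ p.IsChain LAdjacent ∧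
      (∃ u, p.head? = some u ∧ P u) ∧ (∃ u, p.getLast? = some u ∧ Q u) ∧
      ∃ s ∈ pathSteps p, ¬ LStep τ s.1 s.2 ∧ ∀ t ∈ pathSteps p, t ≠ s → LStep τ t.1 t.2 := by
  have hno : ¬ Relation.ReflTransGen (LStep τ) u v := fun h => by
    obtain ⟨p, h1, h2, h3, h4, -⟩ := exists_nodup_isChain_of_reflTransGen h
    exact hFL ⟨p, by rintro rfl; simp at h3, h1, h2, ⟨u, h3, hu⟩, v, h4, hv⟩
  have hadj : LAdjacent x y := hxy.resolve_left fun h => hno (hux.trans (h ▸ hyv))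
  obtain ⟨p, hp1, hp2, hp3, hp4, hp5⟩ := exists_nodup_isChain_of_reflTransGen hux
  obtain ⟨q, hq1, hq2, hq3, hq4, hq5⟩ := exists_nodup_isChain_of_reflTransGen hyv
  have hp0 : p ≠ [] := by rintro rfl; simp at hp3
  have hq0 : q ≠ [] := by rintro rfl; simp at hq3
  have hsteps := pathSteps_append_cases hp2 hq2 hp4 hq3
  refine ⟨p ++ q, by simp [hp0], ?_, ?_, ⟨u, ?_, hu⟩, ⟨v, ?_, hv⟩, (x, y), hsteps.1, fun h => ?_,
    hsteps.2⟩
  · refine List.nodup_append'.2 ⟨hp1, hq1, fun z hzp hzq => hno ?_⟩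
    exact (hp5 z hzp).1.trans (hq5 z hzq).2
  · refine List.isChain_append.2 ⟨hp2.imp fun _ _ h => h.lAdjacent,
      hq2.imp fun _ _ h => h.lAdjacent, fun a ha b hb => ?_⟩
    rw [hp4, Option.mem_some_iff] at ha
    rw [hq3, Option.mem_some_iff] at hb
    exact ha ▸ hb ▸ hadj
  · rw [List.head?_append_of_ne_nil _ hp0, hp3]
  · rw [List.getLast?_append_of_ne_nil _ hq0, hq4]
  · exact hno (hux.trans (.head h hyv))

theorem exists_separating_set {n : ℕ} {τ : EdgeConfig n} {P Q : LVertex n → Prop}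
    {i j : ℕ} (hi : i + 1 < n) (hj : j + 1 < n)
    (hcorner : ∃ e, lTau τ e = true ∧ CutsCorner i j e)
    (hFL : ¬ ∃ p : List (LVertex n), p ≠ [] ∧ p.Nodup ∧ p.IsChain (LStep τ) ∧
      (∃ u, p.head? = some u ∧ P u) ∧ (∃ u, p.getLast? = some u ∧ Q u))
    (hAFL : ¬ ∃ p : List (LVertex n), p ≠ [] ∧ p.Nodup ∧ p.IsChain LAdjacent ∧
      (∃ u, p.head? = some u ∧ P u) ∧ (∃ u, p.getLast? = some u ∧ Q u) ∧
      ∃ s ∈ pathSteps p, ¬ LStep τ s.1 s.2 ∧ ∀ t ∈ pathSteps p, t ≠ s → LStep τ t.1 t.2) :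
    ∃ s : LVertex n → Prop, (∀ u, P u → s u) ∧ (∀ u, Q u → ¬ s u) ∧
      ∀ e, lTau τ e = true ∨ CutsCorner i j e → (s (lEdgeEnds e).1 ↔ s (lEdgeEnds e).2) := by
  set S : LVertex n → Prop := fun x => ∃ u, P u ∧ Relation.ReflTransGen (LStep τ) u x with hS
  set T : LVertex n → Prop := fun x => ∃ v, Q v ∧ Relation.ReflTransGen (LStep τ) x v with hT
  have hST : ∀ x y, S x → T y → ¬ (x = y ∨ LAdjacent x y) := by
    rintro x y ⟨u, hu, hux⟩ ⟨v, hv, hyv⟩ hxy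
    exact hAFL (exists_almost_path hFL hu hv hux hxy hyv)
  have hPS : ∀ u, P u → S u := fun u hu => ⟨u, hu, .refl⟩
  have hQT : ∀ u, Q u → T u := fun u hu => ⟨u, hu, .refl⟩
  have hadj : ∀ e : LEdge n, LAdjacent (lEdgeEnds e).1 (lEdgeEnds e).2 := fun e => ⟨e, .inl rfl⟩
  have hstep : ∀ e : LEdge n, lTau τ e = true → LStep τ (lEdgeEnds e).1 (lEdgeEnds e).2 :=
    fun e he => ⟨e, .inl rfl, he⟩
  have hSstep : ∀ e, lTau τ e = true → (S (lEdgeEnds e).1 ↔ S (lEdgeEnds e).2) := fun e he =>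
    ⟨fun ⟨u, hu, h⟩ => ⟨u, hu, h.tail (hstep e he)⟩,
      fun ⟨u, hu, h⟩ => ⟨u, hu, h.tail (hstep e he).symm⟩⟩
  have hTstep : ∀ e, lTau τ e = true → (T (lEdgeEnds e).1 ↔ T (lEdgeEnds e).2) := fun e he =>
    ⟨fun ⟨u, hu, h⟩ => ⟨u, hu, h.head (hstep e he).symm⟩,
      fun ⟨u, hu, h⟩ => ⟨u, hu, h.head (hstep e he)⟩⟩
  by_cases hSK : ∀ e, CutsCorner i j e → ¬ S (lEdgeEnds e).1 ∧ ¬ S (lEdgeEnds e).2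
  · refine ⟨S, hPS, fun u hu h => hST u u h (hQT u hu) (.inl rfl), fun e he => ?_⟩
    exact he.elim (hSstep e) fun h => by simp [hSK e h]
  by_cases hTK : ∀ e, CutsCorner i j e → ¬ T (lEdgeEnds e).1 ∧ ¬ T (lEdgeEnds e).2
  · refine ⟨fun u => ¬ T u, fun u hu h => hST u u (hPS u hu) h (.inl rfl),
      fun u hu => not_not.2 (hQT u hu), fun e he => ?_⟩
    exact he.elim (fun h => not_congr (hTstep e h)) fun h => by simp [hTK e h]
  exfalso
  let W : LVertex n := (⟨i, by omega⟩, ⟨j + 1, by omega⟩)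
  let N : LVertex n := (⟨i + 1, by omega⟩, ⟨j + 2, by omega⟩)
  let E : LVertex n := (⟨i + 2, by omega⟩, ⟨j + 1, by omega⟩)
  let O : LVertex n := (⟨i + 1, by omega⟩, ⟨j, by omega⟩)
  have hcut : ∀ e : LEdge n, CutsCorner i j e → lEdgeEnds e = (O, W) ∨ lEdgeEnds e = (O, E) ∨
      lEdgeEnds e = (W, N) ∨ lEdgeEnds e = (E, N) := by
    rintro ⟨⟨a, b⟩, d⟩ ⟨ha, hb, hd⟩
    cases d <;> simp at ha hb hd <;> simp [lEdgeEnds, W, N, E, O, Fin.ext_iff] <;> omega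
  have h1 : LAdjacent O W := hadj ((⟨i, by omega⟩, ⟨j, by omega⟩), false)
  have h2 : LAdjacent O E := hadj ((⟨i + 1, by omega⟩, ⟨j, by omega⟩), true)
  have h3 : LAdjacent W N := hadj ((⟨i, by omega⟩, ⟨j + 1, by omega⟩), true)
  have h4 : LAdjacent E N := hadj ((⟨i + 1, by omega⟩, ⟨j + 1, by omega⟩), false)
  have h1' := h1.symm
  have h2' := h2.symm
  have h3' := h3.symm
  have h4' := h4.symm
  have hSex : S O ∨ S W ∨ S E ∨ S N := by
    by_contra! h
    refine hSK fun e he => ?_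
    rcases hcut e he with h' | h' | h' | h' <;> rw [h'] <;> simp only [h, not_false_iff, and_self]
  have hTex : T O ∨ T W ∨ T E ∨ T N := by
    by_contra! h
    refine hTK fun e he => ?_
    rcases hcut e he with h' | h' | h' | h' <;> rw [h'] <;> simp only [h, not_false_iff, and_self]
  obtain ⟨e, he, hec⟩ := hcorner
  have hSe := hSstep e he
  have hTe := hTstep e he
  have hdis : ∀ x y, (x = y ∨ LAdjacent x y) → ¬ (S x ∧ T y) := fun x y h h' =>
    hST x y h'.1 h'.2 h
  have k1 := hdis O O (.inl rfl)
  have k2 := hdis W W (.inl rfl)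
  have k3 := hdis E E (.inl rfl)
  have k4 := hdis N N (.inl rfl)
  replace h1 := hdis O W (.inr h1)
  replace h2 := hdis O E (.inr h2)
  replace h3 := hdis W N (.inr h3)
  replace h4 := hdis E N (.inr h4)
  replace h1' := hdis W O (.inr h1')
  replace h2' := hdis E O (.inr h2')
  replace h3' := hdis N W (.inr h3')
  replace h4' := hdis N E (.inr h4')
  have hends : ((S O ↔ S W) ∧ (T O ↔ T W)) ∨ ((S O ↔ S E) ∧ (T O ↔ T E)) ∨
      ((S W ↔ S N) ∧ (T W ↔ T N)) ∨ ((S E ↔ S N) ∧ (T E ↔ T N)) := by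
    rcases hcut e hec with h | h | h | h <;> rw [h] at hSe hTe
    · exact .inl ⟨hSe, hTe⟩
    · exact .inr (.inl ⟨hSe, hTe⟩)
    · exact .inr (.inr (.inl ⟨hSe, hTe⟩))
    · exact .inr (.inr (.inr ⟨hSe, hTe⟩))
  clear hSe hTe hcut hSstep hTstep hSK hTK hPS hQT hST hdis
  clear_value W N E O S T
  generalize S O = s1, S W = s2, S E = s3, S N = s4, T O = t1, T W = t2, T E = t3, T N = t4 at *
  clear * - hSex hTex k1 k2 k3 k4 h1 h2 h3 h4 h1' h2' h3' h4' hends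
  grind

theorem exists_monoPath_of_reflTransGen {n : ℕ} {σ τ : EdgeConfig n} {i j : ℕ}
    (hout : ∀ e, ¬ InSquare i j e → greenB σ e = greenB τ e) {e f : Edge n}
    (he : ¬ InSquare i j e)
    (h : Relation.ReflTransGen (fun e f => EdgeAdj e f ∧
      (greenB τ e, InSquare i j e) = (greenB τ f, InSquare i j f)) e f) :
    ∃ g p, MonoPath σ g p ∧ MonoPath τ g p ∧ p.head? = some e ∧ p.getLast? = some f := by
  obtain ⟨p, hnd, hch, hhd, hlast, -⟩ := exists_nodup_isChain_of_reflTransGen h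
  have hp : p ≠ [] := by rintro rfl; simp at hhd
  have hch' : p.IsChain EdgeAdj := hch.imp fun _ _ h => h.1
  have hall := List.IsChain.forall_of_head
    (P := fun f => (greenB τ f, InSquare i j f) = (greenB τ e, InSquare i j e)) hch hhd rfl
    fun _ _ _ _ h h' => h.2.symm.trans h'
  have hg : ∀ f ∈ p, greenB τ f = greenB τ e := fun f hf => (Prod.ext_iff.1 (hall f hf)).1
  have hin : ∀ f ∈ p, ¬ InSquare i j f := fun f hf hfi =>
    he ((iff_of_eq (Prod.ext_iff.1 (hall f hf)).2).1 hfi)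
  exact ⟨greenB τ e, p, ⟨hp, hnd, hch', fun f hf => (hout f (hin f hf)).trans (hg f hf)⟩,
    ⟨hp, hnd, hch', hg⟩, hhd, hlast⟩

theorem SplitsAlong.mono {n : ℕ} {α : Type*} {c : Edge n → α} {d d' : LEdge n → Prop}
    (h : SplitsAlong c d) (hd : ∀ e, d e → d' e) : SplitsAlong c d' := fun i j =>
  (h i j).imp_right (Or.imp (And.imp_right (And.imp_right (hd _)))
    (And.imp_right (And.imp_right (hd _))))

theorem exists_vertFaultLine_or_almost {n : ℕ} {σ τ : EdgeConfig n} (hσ : IceRule σ)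
    (hτ : IceRule τ) {i j : ℕ} (hi : i + 1 < n) (hj : j + 1 < n)
    (hred : ∀ e, InSquare i j e → greenB τ e = false)
    (hout : ∀ e, ¬ InSquare i j e → greenB σ e = greenB τ e)
    (hcross : HasGreenCross σ) (hno : ¬ HorizGreenBridge τ) :
    HasVertFaultLine τ ∨ ∃ p, IsVertAlmostFaultLine τ p := by
  by_contra! h
  obtain ⟨⟨p, hp, ⟨a, ha⟩, b, hb⟩, q, hq⟩ := hcross
  have hside : ∀ k, ¬ InSquare (n := n) i j (Edge.horiz 0 k) := fun k h => by
    have := h.1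
    simp at this
  obtain ⟨s, hs, hs', hcl⟩ := exists_separating_set hi hj
    (exists_lTau_cutsCorner hτ hred hout hp ha (hside a) fun h => hno ⟨p, h, ⟨a, ha⟩, b, hb⟩)
    h.1 (not_exists.2 h.2)
  obtain ⟨k, k', hk⟩ := exists_horiz_crossing ((splitsAlong_greenB_inSquare hτ hred).mono hcl)
    (fun i => hs (i, Fin.last n) rfl) (fun i => hs' (i, 0) rfl)
  obtain ⟨g, r, hrσ, hrτ, hhd, hlast⟩ := exists_monoPath_of_reflTransGen hout (hside k) hk
  cases g with
  | true => exact hno ⟨r, hrτ, ⟨k, hhd⟩, k', hlast⟩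
  | false => exact not_horizBridge_of_vertBridge hσ (by simp) ⟨hrσ, ⟨k, hhd⟩, k', hlast⟩ hq

theorem exists_horizFaultLine_or_almost {n : ℕ} {σ τ : EdgeConfig n} (hσ : IceRule σ)
    (hτ : IceRule τ) {i j : ℕ} (hi : i + 1 < n) (hj : j + 1 < n)
    (hred : ∀ e, InSquare i j e → greenB τ e = false)
    (hout : ∀ e, ¬ InSquare i j e → greenB σ e = greenB τ e)
    (hcross : HasGreenCross σ) (hno : ¬ VertGreenBridge τ) :
    HasHorizFaultLine τ ∨ ∃ p, IsHorizAlmostFaultLine τ p := by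
  by_contra! h
  obtain ⟨⟨q, hq⟩, p, hp, ⟨a, ha⟩, b, hb⟩ := hcross
  have hside : ∀ k, ¬ InSquare (n := n) i j (Edge.vert k (Fin.last n)) := fun k h => by
    have := h.2
    simp at this
    omega
  obtain ⟨s, hs, hs', hcl⟩ := exists_separating_set hi hj
    (exists_lTau_cutsCorner hτ hred hout hp ha (hside a) fun h => hno ⟨p, h, ⟨a, ha⟩, b, hb⟩)
    h.1 (not_exists.2 h.2)
  obtain ⟨k, k', hk⟩ := exists_vert_crossing ((splitsAlong_greenB_inSquare hτ hred).mono hcl)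
    (fun i => hs (0, i) rfl) (fun i => hs' (Fin.last n, i) rfl)
  obtain ⟨g, r, hrσ, hrτ, hhd, hlast⟩ := exists_monoPath_of_reflTransGen hout (hside k) hk
  cases g with
  | true => exact hno ⟨r, hrτ, ⟨k, hhd⟩, k', hlast⟩
  | false => exact not_horizBridge_of_vertBridge hσ (by simp) hq ⟨hrσ, ⟨k, hhd⟩, k', hlast⟩

theorem GlauberMoveAt.greenB_eq {n : ℕ} {σ τ : EdgeConfig n} {i j : ℕ} {hi : i + 1 < n}
    {hj : j + 1 < n} (h : GlauberMoveAt σ τ i j hi hj) :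
    (∀ e, ¬ InSquare i j e → greenB σ e = greenB τ e) ∧
      ((∀ e, InSquare i j e → greenB τ e = false) ∨
        ∀ e, InSquare i j e → greenB τ e = true) := by
  obtain ⟨h, rfl⟩ := h
  refine ⟨fun e he => ?_, ?_⟩
  · rw [inSquare_iff hi hj] at he
    simp only [greenB, flipSquare, if_neg he]
  · have hflip : ∀ e, InSquare i j e →
        greenB (flipSquare σ (squareEdges n i j hi hj)) e = !(greenB σ e) := fun e he => by
      rw [inSquare_iff hi hj] at he
      simp only [greenB, flipSquare, if_pos he]
      cases σ e <;> cases greenOrient e <;> rfl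
    have hpar : (i + j) % 2 = 0 ∨ (i + j) % 2 = 1 := by omega
    have hpar1 : (i + 1 + j) % 2 = 1 - (i + j) % 2 := by omega
    have hpar2 : (i + (j + 1)) % 2 = 1 - (i + j) % 2 := by omega
    have hpar3 : (i + 1 + (j + 1)) % 2 = (i + j) % 2 := by omega
    have hsq : (∀ e : Edge n, InSquare i j e → greenB σ e = true) ∨
        ∀ e : Edge n, InSquare i j e → greenB σ e = false := by
      simp only [inSquare_iff hi hj]
      simp only [forall_eq_or_imp, forall_eq, greenB, squareEdges, greenOrient, hpar1, hpar2, hpar3]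
      simp only [DirectedSquare, squareEdges] at h
      rcases h with ⟨h1, h2, h3, h4⟩ | ⟨h1, h2, h3, h4⟩ <;> rcases hpar with hpar | hpar <;>
        simp [h1, h2, h3, h4, hpar]
    exact hsq.imp (fun h e he => by rw [hflip e he, h e he]; rfl)
      fun h e he => by rw [hflip e he, h e he]; rfl

theorem MonoPath.of_le {n : ℕ} {σ τ : EdgeConfig n}
    (h : ∀ e, greenB σ e = true → greenB τ e = true) {p : List (Edge n)}
    (hp : MonoPath σ true p) : MonoPath τ true p :=
  ⟨hp.1, hp.2.1, hp.2.2.1, fun e he => h e (hp.2.2.2 e he)⟩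

/-- `∂C_G ⊆ C_FL ∪ C_AFL`. -/
theorem boundary_CG_subset (n : ℕ) (hn : 1 ≤ n) :
    boundaryCG n ⊆ CFL n ∪ CAFL n := by
  rintro τ ⟨hτ, hτG, σ, ⟨hσ, hcross⟩, i, j, hi, hj, hmove⟩
  obtain ⟨hout, hred | hgreen⟩ := hmove.greenB_eq
  · by_cases hH : HorizGreenBridge τ
    · have hV : ¬ VertGreenBridge τ := fun hV => hτG ⟨hτ, hH, hV⟩
      exact (exists_horizFaultLine_or_almost hσ hτ hi hj hred hout hcross hV).imp
        (fun h => ⟨hτ, .inl h⟩) fun h => ⟨hτ, .inl h⟩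
    · exact (exists_vertFaultLine_or_almost hσ hτ hi hj hred hout hcross hH).imp
        (fun h => ⟨hτ, .inr h⟩) fun h => ⟨hτ, .inr h⟩
  · have hle : ∀ e, greenB σ e = true → greenB τ e = true := fun e he =>
      (em (InSquare i j e)).elim (hgreen e) fun h => hout e h ▸ he
    obtain ⟨⟨p, hp, hp'⟩, q, hq, hq'⟩ := hcross
    exact absurd ⟨hτ, ⟨p, hp.of_le hle, hp'⟩, q, hq.of_le hle, hq'⟩ hτG
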